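/- (Proposition 2, Case 1) Suppose M > 0, c1, c2 > 0, α11 > α21 > 0, α12 > α22 > 0, α31 > 0, α32 > 0, and let q1(n1) = α11 − α21·exp(−α31·n1) and q2(n2) = α12 − α22·exp(−α32·n2). Then at every point (p_b, n1, n2) with p_b ≥ 0, n1 ≥ 0, n2 ≥ 0, the Hessian matrix of the bundle profit function F_K(p_b, n1, n2) = M·p_b·(1 − p_b²/(2·q1(n1)·q2(n2))) − n1·c1 − n2·c2 is negative semidefinite; in particular its first-order principal minors are non-positive, its second-order principal minors are non-negative, and its determinant is non-positive, so F_K is concave on the convex region {(p_b, n1, n2) : p_b ≥ 0, n1 ≥ 0, n2 ≥ 0, p_b ≤ q1(n1), p_b ≤ q2(n2)}. -/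

import Mathlib

open Real Set

open scoped Topology

/-- The quality `α - β * exp (-γ * n)` is positive for `n ≥ 0` when `0 < β < α` and `0 < γ`. -/
lemma quality_pos {α β γ n : ℝ} (hβ : 0 < β) (hα : β < α) (hγ : 0 < γ) (hn : 0 ≤ n) :
    0 < α - β * exp (-γ * n) := by
  have h : exp (-γ * n) ≤ 1 := exp_le_one_iff.2 (by nlinarith)
  nlinarith

lemma quality_concaveOn {α β γ : ℝ} (hβ : 0 ≤ β) :
    ConcaveOn ℝ univ fun n => α - β * exp (-γ * n) := by
  refine ⟨convex_univ, fun x _ y _ a b ha hb hab => ?_⟩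
  have h := convexOn_exp.2 (mem_univ (-γ * x)) (mem_univ (-γ * y)) ha hb hab
  simp only [smul_eq_mul] at h ⊢
  rw [show -γ * (a * x + b * y) = a * (-γ * x) + b * (-γ * y) by ring]
  have h' := mul_le_mul_of_nonneg_left h hβ
  have hα : a * α + b * α = α := by rw [← add_mul, hab, one_mul]
  linarith

lemma quality_hasDerivAt (α β γ n : ℝ) :
    HasDerivAt (fun n => α - β * exp (-γ * n)) (β * γ * exp (-γ * n)) n := by
  have h := ((((hasDerivAt_id n).const_mul (-γ)).exp).const_mul β).const_sub α
  refine h.congr_deriv ?_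
  simp only [id]
  ring

/-- The tangent plane inequality for `p ^ 3 / (a * b)` on the positive orthant. -/
lemma tangent_le_cube_div {p a b p₀ a₀ b₀ : ℝ} (hp : 0 ≤ p) (ha : 0 < a) (hb : 0 < b)
    (hp₀ : 0 ≤ p₀) (ha₀ : 0 < a₀) (hb₀ : 0 < b₀) :
    p₀ ^ 2 / (a₀ * b₀) * (3 * p - p₀ * (a / a₀) - p₀ * (b / b₀)) ≤ p ^ 3 / (a * b) := by
  have amgm : ∀ X Y : ℝ, 0 ≤ X → 0 ≤ Y → X * Y * (3 * p - X - Y) ≤ p ^ 3 := by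
    intro X Y hX hY
    rcases le_total (3 * p - X - Y) 0 with h | h
    · exact (mul_nonpos_of_nonneg_of_nonpos (mul_nonneg hX hY) h).trans (pow_nonneg hp 3)
    · have h1 := mul_nonneg (sq_nonneg (X - Y)) h
      have h2 := mul_nonneg (sq_nonneg (p - (X + Y) / 2)) (by positivity : 0 ≤ p + (X + Y))
      linarith
  rw [le_div_iff₀ (by positivity)]
  calc _ = p₀ * (a / a₀) * (p₀ * (b / b₀)) * (3 * p - p₀ * (a / a₀) - p₀ * (b / b₀)) := by
        field_simp
    _ ≤ p ^ 3 := amgm _ _ (by positivity) (by positivity)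

/-- The second derivative of `M p - K p³ u(n₁) v(n₂) - n₁ c₁ - n₂ c₂`. -/
lemma iteratedFDeriv_two_profit {M K c₁ c₂ u₂ v₂ : ℝ} {u u' v v' : ℝ → ℝ} {x : ℝ × ℝ × ℝ}
    (hu : ∀ᶠ t in 𝓝 x.2.1, HasDerivAt u (u' t) t) (hu' : HasDerivAt u' u₂ x.2.1)
    (hv : ∀ᶠ t in 𝓝 x.2.2, HasDerivAt v (v' t) t) (hv' : HasDerivAt v' v₂ x.2.2)
    (y z : ℝ × ℝ × ℝ) :
    iteratedFDeriv ℝ 2 (fun x : ℝ × ℝ × ℝ =>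
        M * x.1 - K * (x.1 ^ 3 * u x.2.1 * v x.2.2) - x.2.1 * c₁ - x.2.2 * c₂) x ![y, z] =
      -K * (6 * x.1 * u x.2.1 * v x.2.2 * (y.1 * z.1)
        + 3 * x.1 ^ 2 * u' x.2.1 * v x.2.2 * (y.1 * z.2.1 + y.2.1 * z.1)
        + 3 * x.1 ^ 2 * u x.2.1 * v' x.2.2 * (y.1 * z.2.2 + y.2.2 * z.1)
        + x.1 ^ 3 * u₂ * v x.2.2 * (y.2.1 * z.2.1)
        + x.1 ^ 3 * u' x.2.1 * v' x.2.2 * (y.2.1 * z.2.2 + y.2.2 * z.2.1)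
        + x.1 ^ 3 * u x.2.1 * v₂ * (y.2.2 * z.2.2)) := by
  let d₀ : ℝ × ℝ × ℝ →L[ℝ] ℝ := .fst ℝ ℝ (ℝ × ℝ)
  let d₁ : ℝ × ℝ × ℝ →L[ℝ] ℝ := (ContinuousLinearMap.fst ℝ ℝ ℝ).comp (.snd ℝ ℝ (ℝ × ℝ))
  let d₂ : ℝ × ℝ × ℝ →L[ℝ] ℝ := (ContinuousLinearMap.snd ℝ ℝ ℝ).comp (.snd ℝ ℝ (ℝ × ℝ))
  have hd₀ (w : ℝ × ℝ × ℝ) : HasFDerivAt (fun w : ℝ × ℝ × ℝ => w.1) d₀ w := d₀.hasFDerivAt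
  have hd₁ (w : ℝ × ℝ × ℝ) : HasFDerivAt (fun w : ℝ × ℝ × ℝ => w.2.1) d₁ w := d₁.hasFDerivAt
  have hd₂ (w : ℝ × ℝ × ℝ) : HasFDerivAt (fun w : ℝ × ℝ × ℝ => w.2.2) d₂ w := d₂.hasFDerivAt
  have gradient : fderiv ℝ (fun x : ℝ × ℝ × ℝ =>
      M * x.1 - K * (x.1 ^ 3 * u x.2.1 * v x.2.2) - x.2.1 * c₁ - x.2.2 * c₂) =ᶠ[𝓝 x]
      fun w => (M - K * (3 * w.1 ^ 2 * u w.2.1 * v w.2.2)) • d₀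
        + (-K * (w.1 ^ 3 * u' w.2.1 * v w.2.2) - c₁) • d₁
        + (-K * (w.1 ^ 3 * u w.2.1 * v' w.2.2) - c₂) • d₂ := by
    filter_upwards [(hd₁ x).continuousAt.eventually hu, (hd₂ x).continuousAt.eventually hv]
      with w hw₁ hw₂
    have hU : HasFDerivAt (fun w : ℝ × ℝ × ℝ => u w.2.1) (u' w.2.1 • d₁) w :=
      hw₁.comp_hasFDerivAt w (hd₁ w)
    have hV : HasFDerivAt (fun w : ℝ × ℝ × ℝ => v w.2.2) (v' w.2.2 • d₂) w :=
      hw₂.comp_hasFDerivAt w (hd₂ w)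
    refine HasFDerivAt.fderiv ((((((hd₀ w).const_mul M).sub
      (((((hd₀ w).pow 3).mul hU).mul hV).const_mul K)).sub ((hd₁ w).mul_const c₁)).sub
      ((hd₂ w).mul_const c₂)).congr_fderiv ?_)
    refine ContinuousLinearMap.ext fun z => ?_
    simp
    ring
  have hU : HasFDerivAt (fun w : ℝ × ℝ × ℝ => u w.2.1) (u' x.2.1 • d₁) x :=
    hu.self_of_nhds.comp_hasFDerivAt x (hd₁ x)
  have hV : HasFDerivAt (fun w : ℝ × ℝ × ℝ => v w.2.2) (v' x.2.2 • d₂) x :=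
    hv.self_of_nhds.comp_hasFDerivAt x (hd₂ x)
  have hU' : HasFDerivAt (fun w : ℝ × ℝ × ℝ => u' w.2.1) (u₂ • d₁) x :=
    hu'.comp_hasFDerivAt x (hd₁ x)
  have hV' : HasFDerivAt (fun w : ℝ × ℝ × ℝ => v' w.2.2) (v₂ • d₂) x :=
    hv'.comp_hasFDerivAt x (hd₂ x)
  have hg₀ := ((((((hd₀ x).pow 2).const_mul 3).mul hU).mul hV).const_mul K).const_sub M
  have hg₁ := (((((hd₀ x).pow 3).mul hU').mul hV).const_mul (-K)).sub_const c₁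
  have hg₂ := (((((hd₀ x).pow 3).mul hU).mul hV').const_mul (-K)).sub_const c₂
  have hessian := ((hg₀.smul_const d₀).add (hg₁.smul_const d₁)).add (hg₂.smul_const d₂)
  rw [iteratedFDeriv_two_apply, gradient.fderiv_eq]
  erw [hessian.fderiv]
  simp [d₀, d₁, d₂]
  ring

/-- The quadratic form behind the Hessian of `p³ u v` is nonnegative when `u u'' ≥ 2 u'²`
and `v v'' ≥ 2 v'²`. -/
lemma cube_mul_mul_quadratic_nonneg {p u u' u₂ v v' v₂ : ℝ} (hp : 0 ≤ p) (hu : 0 < u)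
    (hv : 0 < v) (hu₂ : 2 * u' ^ 2 ≤ u * u₂) (hv₂ : 2 * v' ^ 2 ≤ v * v₂) (a b c : ℝ) :
    0 ≤ 6 * p * u * v * (a * a) + 3 * p ^ 2 * u' * v * (a * b + b * a)
      + 3 * p ^ 2 * u * v' * (a * c + c * a) + p ^ 3 * u₂ * v * (b * b)
      + p ^ 3 * u' * v' * (b * c + c * b) + p ^ 3 * u * v₂ * (c * c) := by
  have huv : 0 < u * v := mul_pos hu hv
  refine nonneg_of_mul_nonneg_right ?_ huv
  have h₁ : 0 ≤ (p * b * v) ^ 2 * (u * u₂ - 2 * u' ^ 2) :=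
    mul_nonneg (sq_nonneg _) (sub_nonneg.2 hu₂)
  have h₂ : 0 ≤ (p * c * u) ^ 2 * (v * v₂ - 2 * v' ^ 2) :=
    mul_nonneg (sq_nonneg _) (sub_nonneg.2 hv₂)
  have h₃ := sq_nonneg (2 * (u * v * a) + p * b * u' * v + p * c * v' * u)
  have h₄ := sq_nonneg (p * b * u' * v - p * c * v' * u)
  have key : 0 ≤ p * ((p * b * v) ^ 2 * (u * u₂ - 2 * u' ^ 2)
      + (p * c * u) ^ 2 * (v * v₂ - 2 * v' ^ 2)
      + 3 / 2 * (2 * (u * v * a) + p * b * u' * v + p * c * v' * u) ^ 2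
      + 1 / 2 * (p * b * u' * v - p * c * v' * u) ^ 2) := by positivity
  linarith

/-- Sign conditions on the principal minors of a `3 × 3` negative semidefinite matrix. -/
lemma Matrix.PosSemidef.neg_minors {H : Matrix (Fin 3) (Fin 3) ℝ} (h : (-H).PosSemidef) :
    (∀ i, H i i ≤ 0) ∧ (∀ i j, i ≠ j → 0 ≤ H i i * H j j - H i j * H j i) ∧ H.det ≤ 0 := by
  refine ⟨fun i => ?_, fun i j _ => ?_, ?_⟩
  · simpa using h.diag_nonneg (i := i)
  · have := (h.submatrix ![i, j]).det_nonneg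
    rw [Matrix.det_fin_two] at this
    simpa using this
  · have := h.det_nonneg
    rw [Matrix.det_neg] at this
    norm_num at this
    exact this

/-- First and second derivatives of the reciprocal `u` of the quality at `n ≥ 0`, together with
the inequality `2 u'² ≤ u u''`. -/
lemma exists_derivs_inv_quality {α β γ n : ℝ} (hβ : 0 < β) (hα : β < α) (hγ : 0 < γ)
    (hn : 0 ≤ n) : ∃ (u' : ℝ → ℝ) (u₂ : ℝ),
      (∀ᶠ t in 𝓝 n, HasDerivAt (fun t => (α - β * exp (-γ * t))⁻¹) (u' t) t) ∧
      HasDerivAt u' u₂ n ∧ 2 * u' n ^ 2 ≤ (α - β * exp (-γ * n))⁻¹ * u₂ := by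
  have hq := quality_pos hβ hα hγ hn
  have hd := quality_hasDerivAt α β γ
  have hd' : HasDerivAt (fun t => β * γ * exp (-γ * t)) (-(β * γ ^ 2 * exp (-γ * n))) n := by
    have h := (((hasDerivAt_id n).const_mul (-γ)).exp).const_mul (β * γ)
    refine h.congr_deriv ?_
    simp only [id]
    ring
  refine ⟨fun t => -(β * γ * exp (-γ * t)) / (α - β * exp (-γ * t)) ^ 2, _, ?_,
    hd'.neg.div ((hd n).pow 2) (pow_ne_zero 2 hq.ne'), ?_⟩
  · filter_upwards [(hd n).continuousAt.eventually (lt_mem_nhds hq)] with t ht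
    exact (hd t).inv ht.ne'
  · have hE := exp_pos (-γ * n)
    simp only [Pi.neg_apply, Pi.pow_apply]
    generalize exp (-γ * n) = E at *
    generalize α - β * E = Q at *
    rw [← sub_nonneg]
    have : 0 ≤ β * γ ^ 2 * E / Q ^ 3 := by positivity
    convert this using 1
    field_simp
    ring

/-- Proposition 2, Case 1: With `M > 0`, `c1, c2 > 0`,
`α11 > α21 > 0`, `α12 > α22 > 0`, `α31, α32 > 0`,
`q1 n1 = α11 - α21 * exp (-α31 * n1)` and `q2 n2 = α12 - α22 * exp (-α32 * n2)`,
at every point `(p_b, n1, n2)` with nonnegative coordinates, the Hessian matrix of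
the bundle profit `F_K (p_b, n1, n2) = M * p_b * (1 - p_b ^ 2 / (2 * q1 n1 * q2 n2))
- n1 * c1 - n2 * c2` is negative semidefinite; in particular its first-order
principal minors are non-positive, its second-order principal minors are
non-negative, and its determinant is non-positive, so `F_K` is concave on the
convex region `{(p_b, n1, n2) : p_b, n1, n2 ≥ 0, p_b ≤ q1 n1, p_b ≤ q2 n2}`. -/
theorem bundle_profit_concave (M c1 c2 α11 α21 α31 α12 α22 α32 : ℝ)
    (hM : 0 < M) (hc1 : 0 < c1) (hc2 : 0 < c2)
    (h11 : α21 < α11) (h21 : 0 < α21) (h12 : α22 < α12) (h22 : 0 < α22)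
    (h31 : 0 < α31) (h32 : 0 < α32) :
    let q1 : ℝ → ℝ := fun n1 => α11 - α21 * Real.exp (-α31 * n1)
    let q2 : ℝ → ℝ := fun n2 => α12 - α22 * Real.exp (-α32 * n2)
    let F : ℝ × ℝ × ℝ → ℝ := fun x =>
      M * x.1 * (1 - x.1 ^ 2 / (2 * q1 x.2.1 * q2 x.2.2)) - x.2.1 * c1 - x.2.2 * c2
    let e : Fin 3 → ℝ × ℝ × ℝ := ![(1, 0, 0), (0, 1, 0), (0, 0, 1)]
    (∀ x : ℝ × ℝ × ℝ, 0 ≤ x.1 → 0 ≤ x.2.1 → 0 ≤ x.2.2 →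
      let H : Matrix (Fin 3) (Fin 3) ℝ :=
        Matrix.of fun i j => iteratedFDeriv ℝ 2 F x ![e i, e j]
      Matrix.PosSemidef (-H) ∧
      (∀ i, H i i ≤ 0) ∧
      (∀ i j, i ≠ j → 0 ≤ H i i * H j j - H i j * H j i) ∧
      H.det ≤ 0) ∧
    ConcaveOn ℝ
      {x : ℝ × ℝ × ℝ | 0 ≤ x.1 ∧ 0 ≤ x.2.1 ∧ 0 ≤ x.2.2 ∧
        x.1 ≤ q1 x.2.1 ∧ x.1 ≤ q2 x.2.2} F := by
  intro q1 q2 F e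
  have hF : F = fun x => M * x.1 - M / 2 * (x.1 ^ 3 * (q1 x.2.1)⁻¹ * (q2 x.2.2)⁻¹)
      - x.2.1 * c1 - x.2.2 * c2 := by
    funext x
    simp only [F]
    generalize q1 x.2.1 = a, q2 x.2.2 = b
    ring1
  constructor
  · intro x hp hn₁ hn₂ H
    obtain ⟨u', u₂, hu, hu', hu₂⟩ := exists_derivs_inv_quality h21 h11 h31 hn₁
    obtain ⟨v', v₂, hv, hv', hv₂⟩ := exists_derivs_inv_quality h22 h12 h32 hn₂
    have hH (i j : Fin 3) : H i j = _ :=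
      (congrArg (fun G => iteratedFDeriv ℝ 2 G x ![e i, e j]) hF).trans
        (iteratedFDeriv_two_profit (u := fun t => (q1 t)⁻¹) (v := fun t => (q2 t)⁻¹)
          hu hu' hv hv' (e i) (e j))
    have hneg : (-H).PosSemidef := by
      refine .of_dotProduct_mulVec_nonneg ?_ fun w => ?_
      · ext i j
        simp only [Matrix.conjTranspose_apply, Matrix.neg_apply, star_trivial, hH]
        ring
      · have h := mul_nonneg (half_pos hM).le (cube_mul_mul_quadratic_nonneg hp
          (inv_pos.2 (quality_pos h21 h11 h31 hn₁)) (inv_pos.2 (quality_pos h22 h12 h32 hn₂))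
          hu₂ hv₂ (w 0) (w 1) (w 2))
        simp only [dotProduct, Matrix.mulVec, Fin.sum_univ_three, Matrix.neg_apply, hH,
          Pi.star_apply, star_trivial]
        simp [e]
        refine h.trans_eq ?_
        simp only [q1, q2]
        ring_nf
    exact ⟨hneg, hneg.neg_minors⟩
  · have hq1 : ConcaveOn ℝ univ q1 := quality_concaveOn h21.le
    have hq2 : ConcaveOn ℝ univ q2 := quality_concaveOn h22.le
    refine ⟨?_, ?_⟩
    · rintro x ⟨hx, hx₁, hx₂, hxq₁, hxq₂⟩ y ⟨hy, hy₁, hy₂, hyq₁, hyq₂⟩ a b ha hb hab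
      have h₁ := hq1.2 (mem_univ x.2.1) (mem_univ y.2.1) ha hb hab
      have h₂ := hq2.2 (mem_univ x.2.2) (mem_univ y.2.2) ha hb hab
      simp only [smul_eq_mul] at h₁ h₂
      simp only [mem_ofPred_eq, Prod.fst_add, Prod.snd_add, Prod.smul_fst, Prod.smul_snd,
        smul_eq_mul]
      refine ⟨by positivity, by positivity, by positivity, le_trans ?_ h₁, le_trans ?_ h₂⟩ <;>
      gcongr
    · rintro x ⟨hx, hx₁, hx₂, -, -⟩ y ⟨hy, hy₁, hy₂, -, -⟩ a b ha hb hab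
      have h₁ := hq1.2 (mem_univ x.2.1) (mem_univ y.2.1) ha hb hab
      have h₂ := hq2.2 (mem_univ x.2.2) (mem_univ y.2.2) ha hb hab
      have hA₀ : 0 < q1 (a * x.2.1 + b * y.2.1) := quality_pos h21 h11 h31 (by positivity)
      have hB₀ : 0 < q2 (a * x.2.2 + b * y.2.2) := quality_pos h22 h12 h32 (by positivity)
      have hp₀ : 0 ≤ a * x.1 + b * y.1 := by positivity
      have tx := tangent_le_cube_div hx (quality_pos h21 h11 h31 hx₁)
        (quality_pos h22 h12 h32 hx₂) hp₀ hA₀ hB₀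
      have ty := tangent_le_cube_div hy (quality_pos h21 h11 h31 hy₁)
        (quality_pos h22 h12 h32 hy₂) hp₀ hA₀ hB₀
      change _ ≤ x.1 ^ 3 / (q1 x.2.1 * q2 x.2.2) at tx
      change _ ≤ y.1 ^ 3 / (q1 y.2.1 * q2 y.2.2) at ty
      change _ * (_ - _ * (q1 x.2.1 / _) - _ * (q2 x.2.2 / _)) ≤ _ at tx
      change _ * (_ - _ * (q1 y.2.1 / _) - _ * (q2 y.2.2 / _)) ≤ _ at ty
      simp only [hF, Prod.fst_add, Prod.snd_add, Prod.smul_fst, Prod.smul_snd,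
        smul_eq_mul] at h₁ h₂ ⊢
      clear_value F q1 q2
      generalize q1 (a * x.2.1 + b * y.2.1) = A₀ at *
      generalize q2 (a * x.2.2 + b * y.2.2) = B₀ at *
      set p₀ := a * x.1 + b * y.1 with hp₀_def
      have h₁' : (a * q1 x.2.1 + b * q1 y.2.1) / A₀ ≤ 1 := (div_le_one hA₀).2 h₁
      have h₂' : (a * q2 x.2.2 + b * q2 y.2.2) / B₀ ≤ 1 := (div_le_one hB₀).2 h₂
      have hw : 0 ≤ p₀ ^ 3 / (A₀ * B₀) := by positivity
      have key : p₀ ^ 3 / (A₀ * B₀) ≤ a * (x.1 ^ 3 / (q1 x.2.1 * q2 x.2.2))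
          + b * (y.1 ^ 3 / (q1 y.2.1 * q2 y.2.2)) := by
        refine le_trans ?_ (add_le_add (mul_le_mul_of_nonneg_left tx ha)
          (mul_le_mul_of_nonneg_left ty hb))
        have e₁ := mul_le_mul_of_nonneg_left h₁' hw
        have e₂ := mul_le_mul_of_nonneg_left h₂' hw
        have e₃ : p₀ ^ 2 / (A₀ * B₀) * (3 * (a * x.1 + b * y.1)) = 3 * (p₀ ^ 3 / (A₀ * B₀)) := by
          rw [← hp₀_def]
          ring
        linear_combination e₁ + e₂ - e₃
      have key' := mul_le_mul_of_nonneg_left key (half_pos hM).le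
      linear_combination key' + M * hp₀_def
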